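/- Let r ≥ 1, let A be a real positive definite symmetric r×r matrix, B ∈ ℝ^r, C ∈ ℝ, and let m ≥ 1 be an integer. Define the mr×mr matrix A' = I_{mr} + E_m ⊗ (A − I_r), where E_m is the m×m matrix with all entries equal to 1/m; explicitly, indexing coordinates of ℝ^{mr} by t = (u−1)r + i with 1 ≤ u ≤ m, 1 ≤ i ≤ r, one has A'_{(u−1)r+i,(v−1)r+j} = δ_{uv}δ_{ij} + (1/m)(A_{ij} − δ_{ij}). Define B' ∈ ℝ^{mr} by B'_{(u−1)r+i} = (2((u−1)r+i) − mr − 1)/(2mr) + (1/m)(B_i − (2i−r−1)/(2r)), and C' = C/m. Then A' is positive definite and for every q ∈ (0,1), F_{A',B',C'}(q) = F_{A,B,C}(q^{1/m}). -/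

import Mathlib

open Real

/-- The `q`-Pochhammer symbol `(q;q)_n = ∏_{k=1}^n (1 - q^k)`. -/
noncomputable def qPoch (q : ℝ) (n : ℕ) : ℝ := ∏ k ∈ Finset.range n, (1 - q ^ (k + 1))

/-- The Nahm sum `F_{A,B,C}(q) = ∑_{n ∈ (ℤ_{≥0})^ι} q^{½nᵀAn + nᵀB + C} / ∏ᵢ (q)_{nᵢ}`. -/
noncomputable def nahmSum {ι : Type*} [Fintype ι]
    (A : Matrix ι ι ℝ) (B : ι → ℝ) (C : ℝ) (q : ℝ) : ℝ :=
  ∑' n : ι → ℕ,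
    q ^ ((1 / 2) * (∑ i, ∑ j, (n i : ℝ) * A i j * (n j : ℝ)) +
          (∑ i, (n i : ℝ) * B i) + C) / ∏ i, qPoch q (n i)

lemma nahm_qPoch_pos {q : ℝ} (h0 : 0 < q) (h1 : q < 1) (n : ℕ) : 0 < qPoch q n := by
  unfold qPoch
  refine Finset.prod_pos fun k _ => ?_
  have : q ^ (k + 1) < 1 := pow_lt_one₀ h0.le h1 (by omega)
  linarith

/-- Euler's series `∑ q^{n(n-1)/2} z^n / (q)_n`. -/
noncomputable def nahmEuler (q : ℝ) : PowerSeries ℝ :=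
  PowerSeries.mk fun n => q ^ (n.choose 2) / qPoch q n

lemma nahm_coeff_rec (p : ℝ) (G : PowerSeries ℝ)
    (h : G = (1 + PowerSeries.X) * PowerSeries.rescale p G) (n : ℕ) :
    PowerSeries.coeff (n + 1) G * (1 - p ^ (n + 1)) = p ^ n * PowerSeries.coeff n G := by
  have := congrArg (PowerSeries.coeff (n + 1)) h
  rw [add_mul, one_mul, map_add, PowerSeries.coeff_succ_X_mul, PowerSeries.coeff_rescale,
    PowerSeries.coeff_rescale] at this
  linarith

lemma nahm_euler_fe {q : ℝ} (h0 : 0 < q) (h1 : q < 1) :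
    nahmEuler q = (1 + PowerSeries.X) * PowerSeries.rescale q (nahmEuler q) := by
  ext n
  rw [add_mul, one_mul, map_add]
  cases n with
  | zero => simp [nahmEuler]
  | succ n =>
    rw [PowerSeries.coeff_succ_X_mul, PowerSeries.coeff_rescale, PowerSeries.coeff_rescale]
    simp only [nahmEuler, PowerSeries.coeff_mk]
    have hp := nahm_qPoch_pos h0 h1 n
    have hq : q ^ (n + 1) < 1 := pow_lt_one₀ h0.le h1 (by omega)
    have hs : qPoch q (n + 1) = qPoch q n * (1 - q ^ (n + 1)) := by
      simp [qPoch, Finset.prod_range_succ]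
    have hc : (n + 1).choose 2 = n + n.choose 2 := by
      rw [Nat.choose_succ_succ' n 1, Nat.choose_one_right]
    have hne : 1 - q ^ (n + 1) ≠ 0 := by linarith
    rw [hs, hc, pow_add]
    field_simp
    ring

lemma nahm_prod_fe {p : ℝ} (h0 : 0 < p) (h1 : p < 1) (m : ℕ) (hm : 0 < m) :
    (∏ u ∈ Finset.range m, PowerSeries.rescale (p ^ u) (nahmEuler (p ^ m))) =
      (1 + PowerSeries.X) * PowerSeries.rescale p
        (∏ u ∈ Finset.range m, PowerSeries.rescale (p ^ u) (nahmEuler (p ^ m))) := by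
  obtain ⟨k, rfl⟩ : ∃ k, m = k + 1 := ⟨m - 1, by omega⟩
  have hq1 : p ^ (k + 1) < 1 := pow_lt_one₀ h0.le h1 (by omega)
  have hfe := nahm_euler_fe (pow_pos h0 (k + 1)) hq1
  have hres : PowerSeries.rescale p
        (∏ u ∈ Finset.range (k + 1), PowerSeries.rescale (p ^ u) (nahmEuler (p ^ (k + 1)))) =
      ∏ u ∈ Finset.range (k + 1),
        PowerSeries.rescale (p ^ (u + 1)) (nahmEuler (p ^ (k + 1))) := by
    rw [map_prod]
    refine Finset.prod_congr rfl fun u _ => ?_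
    rw [PowerSeries.rescale_rescale, ← pow_succ]
  rw [hres, Finset.prod_range_succ', Finset.prod_range_succ, pow_zero, PowerSeries.rescale_one,
    RingHom.id_apply]
  nth_rewrite 2 [hfe]
  ring

lemma nahm_prod_coeff {p : ℝ} (h0 : 0 < p) (h1 : p < 1) (m : ℕ) (hm : 0 < m) (N : ℕ) :
    PowerSeries.coeff N
      (∏ u ∈ Finset.range m, PowerSeries.rescale (p ^ u) (nahmEuler (p ^ m))) =
      p ^ (N.choose 2) / qPoch p N := by
  induction N with
  | zero =>
    rw [PowerSeries.coeff_zero_eq_constantCoeff_apply, map_prod]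
    have : ∀ u, PowerSeries.constantCoeff (PowerSeries.rescale (p ^ u) (nahmEuler (p ^ m))) = 1 := by
      intro u
      rw [← PowerSeries.coeff_zero_eq_constantCoeff_apply, PowerSeries.coeff_rescale]
      simp [nahmEuler, qPoch]
    simp [this, qPoch]
  | succ n ih =>
    have h := nahm_coeff_rec p _ (nahm_prod_fe h0 h1 m hm) n
    have h' := nahm_coeff_rec p _ (nahm_euler_fe h0 h1) n
    rw [ih] at h
    simp only [nahmEuler, PowerSeries.coeff_mk] at h'
    have hq : p ^ (n + 1) < 1 := pow_lt_one₀ h0.le h1 (by omega)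
    have hne : 1 - p ^ (n + 1) ≠ 0 := by linarith
    exact mul_right_cancel₀ hne (h.trans h'.symm)

lemma nahm_column {p : ℝ} (h0 : 0 < p) (h1 : p < 1) (m : ℕ) (hm : 0 < m) (N : ℕ) :
    ∑ k ∈ Finset.piAntidiag (Finset.univ : Finset (Fin m)) N,
      ∏ u : Fin m, ((p ^ (u : ℕ)) ^ (k u) * ((p ^ m) ^ ((k u).choose 2) / qPoch (p ^ m) (k u))) =
      p ^ (N.choose 2) / qPoch p N := by
  rw [← nahm_prod_coeff h0 h1 m hm N, Finset.prod_range, PowerSeries.coeff_prod]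
  symm
  refine Finset.sum_bij (fun l _ => ⇑l) ?_ ?_ ?_ ?_
  · intro l hl
    simpa [Finset.mem_finsuppAntidiag] using hl
  · intro a _ b _ h
    exact DFunLike.coe_injective h
  · intro k hk
    refine ⟨Finsupp.equivFunOnFinite.symm k, ?_, rfl⟩
    simpa [Finset.mem_finsuppAntidiag] using hk
  · intro l _
    simp [PowerSeries.coeff_rescale, nahmEuler]

/-- Summation of nonnegative terms along the fibres of a map with finite fibres. -/
lemma nahm_tsum_fiber {α β : Type*} [DecidableEq β] (φ : α → β) (S : β → Finset α)
    (hS : ∀ a b, a ∈ S b ↔ φ a = b) (f : α → ℝ) (hf : ∀ a, 0 ≤ f a) :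
    ∑' a, f a = ∑' b, ∑ a ∈ S b, f a := by
  have h1 : ∑' a, ENNReal.ofReal (f a) = ∑' b, ENNReal.ofReal (∑ a ∈ S b, f a) := by
    calc ∑' a, ENNReal.ofReal (f a)
        = ∑' a, ∑' b, (if b = φ a then ENNReal.ofReal (f a) else 0) := by
          refine tsum_congr fun a => ?_
          rw [tsum_ite_eq]
      _ = ∑' b, ∑' a, (if b = φ a then ENNReal.ofReal (f a) else 0) := ENNReal.tsum_comm
      _ = ∑' b, ENNReal.ofReal (∑ a ∈ S b, f a) := by
          refine tsum_congr fun b => ?_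
          rw [tsum_eq_sum (s := S b), ENNReal.ofReal_sum_of_nonneg fun a _ => hf a]
          · refine Finset.sum_congr rfl fun a ha => ?_
            rw [if_pos ((hS a b).1 ha).symm]
          · intro a ha
            rw [if_neg]
            intro h
            exact ha ((hS a b).2 h.symm)
  have h2 := congrArg ENNReal.toReal h1
  rw [ENNReal.tsum_toReal_eq (fun _ => ENNReal.ofReal_ne_top),
    ENNReal.tsum_toReal_eq (fun _ => ENNReal.ofReal_ne_top)] at h2
  simpa only [ENNReal.toReal_ofReal (hf _),
    ENNReal.toReal_ofReal (Finset.sum_nonneg fun a _ => hf a)] using h2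

lemma nahm_fin_mod {r m : ℕ} (hr : 0 < r) (u : Fin m) (i : Fin r) :
    (finProdFinEquiv (u, i)).val % r = i.val := by
  simp [finProdFinEquiv, Nat.mod_eq_of_lt i.2]

lemma nahm_quad {r m : ℕ} (hr : 0 < r) (A : Matrix (Fin r) (Fin r) ℝ)
    (A' : Matrix (Fin (m * r)) (Fin (m * r)) ℝ)
    (hA' : ∀ t s : Fin (m * r), A' t s =
      (if t = s then (1 : ℝ) else 0) +
        (1 / (m : ℝ)) *
          (A ⟨t.val % r, Nat.mod_lt _ hr⟩ ⟨s.val % r, Nat.mod_lt _ hr⟩ -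
            if t.val % r = s.val % r then (1 : ℝ) else 0))
    (x : Fin (m * r) → ℝ) :
    ∑ t, ∑ s, x t * A' t s * x s =
      ∑ i, ∑ u, x (finProdFinEquiv (u, i)) ^ 2 +
      (1 / (m : ℝ)) * (∑ i, ∑ j, (∑ u, x (finProdFinEquiv (u, i))) * A i j *
          (∑ u, x (finProdFinEquiv (u, j))) - ∑ i, (∑ u, x (finProdFinEquiv (u, i))) ^ 2) := by
  have key : ∀ g : Fin r → Fin r → ℝ,
      ∑ t : Fin (m * r), ∑ s : Fin (m * r),
        x t * g ⟨t.val % r, Nat.mod_lt _ hr⟩ ⟨s.val % r, Nat.mod_lt _ hr⟩ * x s =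
      ∑ i, ∑ j, (∑ u, x (finProdFinEquiv (u, i))) * g i j *
          (∑ u, x (finProdFinEquiv (u, j))) := by
    intro g
    have inner : ∀ (c : ℝ) (G : Fin r → ℝ),
        ∑ s : Fin (m * r), c * G ⟨s.val % r, Nat.mod_lt _ hr⟩ * x s =
        ∑ j, c * G j * (∑ u, x (finProdFinEquiv (u, j))) := by
      intro c G
      rw [← finProdFinEquiv.sum_comp, Fintype.sum_prod_type_right]
      refine Finset.sum_congr rfl fun j _ => ?_
      simp only [nahm_fin_mod hr, Finset.mul_sum]
    calc _ = ∑ t : Fin (m * r), ∑ j, x t * g ⟨t.val % r, Nat.mod_lt _ hr⟩ j *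
          (∑ u, x (finProdFinEquiv (u, j))) :=
          Finset.sum_congr rfl fun t _ => inner (x t) (g ⟨t.val % r, Nat.mod_lt _ hr⟩)
      _ = _ := by
          rw [← finProdFinEquiv.sum_comp, Fintype.sum_prod_type_right]
          refine Finset.sum_congr rfl fun i _ => ?_
          simp only [nahm_fin_mod hr, Fin.eta]
          rw [Finset.sum_comm]
          refine Finset.sum_congr rfl fun j _ => ?_
          rw [← Finset.sum_mul, ← Finset.sum_mul]
  have k1 := key A
  have k2 := key (fun i j => if i.val = j.val then 1 else 0)
  have k3 : ∑ i, ∑ j, (∑ u, x (finProdFinEquiv (u, i))) *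
      (if (i : Fin r).val = (j : Fin r).val then (1 : ℝ) else 0) *
          (∑ u, x (finProdFinEquiv (u, j))) = ∑ i, (∑ u, x (finProdFinEquiv (u, i))) ^ 2 := by
    refine Finset.sum_congr rfl fun i _ => ?_
    simp [Fin.val_inj, sq]
  have k4 : ∑ t : Fin (m * r), ∑ s : Fin (m * r), x t * (if t = s then (1 : ℝ) else 0) * x s =
      ∑ i, ∑ u, x (finProdFinEquiv (u, i)) ^ 2 := by
    rw [← Fintype.sum_prod_type_right (fun z : Fin m × Fin r => x (finProdFinEquiv z) ^ 2),
      finProdFinEquiv.sum_comp (fun t => x t ^ 2)]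
    simp [sq]
  rw [k3] at k2
  rw [← k4, ← k1, ← k2, ← Finset.sum_sub_distrib, Finset.mul_sum, ← Finset.sum_add_distrib]
  refine Finset.sum_congr rfl fun t _ => ?_
  rw [← Finset.sum_sub_distrib, Finset.mul_sum, ← Finset.sum_add_distrib]
  refine Finset.sum_congr rfl fun s _ => ?_
  rw [hA']
  ring

lemma nahm_posDef {r m : ℕ} (hr : 0 < r) (hm : 0 < m) (A : Matrix (Fin r) (Fin r) ℝ)
    (hA : A.PosDef) (hAs : A.IsSymm)
    (A' : Matrix (Fin (m * r)) (Fin (m * r)) ℝ)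
    (hA' : ∀ t s : Fin (m * r), A' t s =
      (if t = s then (1 : ℝ) else 0) +
        (1 / (m : ℝ)) *
          (A ⟨t.val % r, Nat.mod_lt _ hr⟩ ⟨s.val % r, Nat.mod_lt _ hr⟩ -
            if t.val % r = s.val % r then (1 : ℝ) else 0)) : A'.PosDef := by
  have hm' : (0 : ℝ) < m := by exact_mod_cast hm
  have hform : ∀ {n : ℕ} (M : Matrix (Fin n) (Fin n) ℝ) (x : Fin n → ℝ),
      star x ⬝ᵥ (M.mulVec x) = ∑ t, ∑ s, x t * M t s * x s := by
    intro n M x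
    simp [dotProduct, Matrix.mulVec, Finset.mul_sum, mul_assoc]
  refine Matrix.PosDef.of_dotProduct_mulVec_pos ?_ ?_
  · ext t s
    simp only [Matrix.conjTranspose_apply, star_trivial, hA']
    rw [hAs.apply]
    simp only [eq_comm]
  · intro x hx
    rw [hform, nahm_quad hr A A' hA' x]
    have hcs : ∑ i, (∑ u, x (finProdFinEquiv (u, i))) ^ 2 ≤
        m * ∑ i, ∑ u, x (finProdFinEquiv (u, i)) ^ 2 := by
      rw [Finset.mul_sum]
      refine Finset.sum_le_sum fun i _ => ?_
      simpa using sq_sum_le_card_mul_sum_sq (s := (Finset.univ : Finset (Fin m)))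
        (f := fun u => x (finProdFinEquiv (u, i)))
    have hcs' : (1 / (m : ℝ)) * ∑ i, (∑ u, x (finProdFinEquiv (u, i))) ^ 2 ≤
        ∑ i, ∑ u, x (finProdFinEquiv (u, i)) ^ 2 := by
      rw [one_div, inv_mul_le_iff₀ hm']
      exact hcs
    by_cases hX : (fun i => ∑ u, x (finProdFinEquiv (u, i))) = 0
    · have hX' : ∀ i, ∑ u, x (finProdFinEquiv (u, i)) = 0 := fun i => congrFun hX i
      simp only [hX']
      simp only [zero_mul, Finset.sum_const_zero, ne_eq, OfNat.ofNat_ne_zero, not_false_eq_true,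
        zero_pow, sub_zero, mul_zero, add_zero]
      rw [← Fintype.sum_prod_type_right (fun z : Fin m × Fin r => x (finProdFinEquiv z) ^ 2),
        finProdFinEquiv.sum_comp (fun t => x t ^ 2)]
      obtain ⟨t, ht⟩ := Function.ne_iff.1 hx
      exact Finset.sum_pos' (fun _ _ => sq_nonneg _) ⟨t, Finset.mem_univ _, by
        have : x t ≠ 0 := ht
        positivity⟩
    · have := hA.dotProduct_mulVec_pos hX
      rw [hform] at this
      have h2 := mul_pos (one_div_pos.2 hm') this
      rw [mul_sub]
      linarith

lemma nahm_lin {r m : ℕ} (hr : 0 < r) (hm : 0 < m) (B : Fin r → ℝ)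
    (B' : Fin (m * r) → ℝ)
    (hB' : ∀ t : Fin (m * r), B' t =
      (2 * ((t.val : ℝ) + 1) - (m : ℝ) * r - 1) / (2 * (m : ℝ) * r) +
        (1 / (m : ℝ)) *
          (B ⟨t.val % r, Nat.mod_lt _ hr⟩ -
            (2 * (((t.val % r : ℕ) : ℝ) + 1) - (r : ℝ) - 1) / (2 * (r : ℝ))))
    (u : Fin m) (i : Fin r) :
    B' (finProdFinEquiv (u, i)) = (2 * (u : ℝ) - m + 1) / (2 * m) + B i / m := by
  have hm' : (m : ℝ) ≠ 0 := by positivity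
  have hr' : (r : ℝ) ≠ 0 := by positivity
  rw [hB']
  simp only [nahm_fin_mod hr]
  have : ((finProdFinEquiv (u, i)).val : ℝ) = i + r * u := by
    simp [finProdFinEquiv]
  rw [this]
  field_simp
  ring

/-- Factorization of the general term. -/
lemma nahm_term {r m : ℕ} (hr : 0 < r) (hm : 0 < m)
    (A : Matrix (Fin r) (Fin r) ℝ) (B : Fin r → ℝ) (C : ℝ)
    (A' : Matrix (Fin (m * r)) (Fin (m * r)) ℝ)
    (hA' : ∀ t s : Fin (m * r), A' t s =
      (if t = s then (1 : ℝ) else 0) +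
        (1 / (m : ℝ)) *
          (A ⟨t.val % r, Nat.mod_lt _ hr⟩ ⟨s.val % r, Nat.mod_lt _ hr⟩ -
            if t.val % r = s.val % r then (1 : ℝ) else 0))
    (B' : Fin (m * r) → ℝ)
    (hB' : ∀ t : Fin (m * r), B' t =
      (2 * ((t.val : ℝ) + 1) - (m : ℝ) * r - 1) / (2 * (m : ℝ) * r) +
        (1 / (m : ℝ)) *
          (B ⟨t.val % r, Nat.mod_lt _ hr⟩ -
            (2 * (((t.val % r : ℕ) : ℝ) + 1) - (r : ℝ) - 1) / (2 * (r : ℝ))))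
    {p : ℝ} (h0 : 0 < p) (n : Fin (m * r) → ℕ) (N : Fin r → ℕ)
    (hN : ∀ i, ∑ u, n (finProdFinEquiv (u, i)) = N i) :
    (p ^ m) ^ ((1 / 2) * (∑ i, ∑ j, (n i : ℝ) * A' i j * (n j : ℝ)) +
          (∑ i, (n i : ℝ) * B' i) + C / m) / ∏ i, qPoch (p ^ m) (n i) =
    (p ^ ((1 / 2) * (∑ i, ∑ j, (N i : ℝ) * A i j * (N j : ℝ)) +
          (∑ i, (N i : ℝ) * B i) + C) / ∏ i, p ^ ((N i).choose 2)) *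
      ∏ i, ∏ u : Fin m, ((p ^ (u : ℕ)) ^ (n (finProdFinEquiv (u, i))) *
        ((p ^ m) ^ ((n (finProdFinEquiv (u, i))).choose 2) /
          qPoch (p ^ m) (n (finProdFinEquiv (u, i))))) := by
  have hm' : (m : ℝ) ≠ 0 := by positivity
  have hNr : ∀ i, ∑ u, (n (finProdFinEquiv (u, i)) : ℝ) = N i := by
    intro i
    rw [← hN i]
    push_cast
    rfl
  have hden : ∏ i, qPoch (p ^ m) (n i) =
      ∏ i, ∏ u : Fin m, qPoch (p ^ m) (n (finProdFinEquiv (u, i))) := by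
    rw [← Fintype.prod_prod_type_right
      (fun z : Fin m × Fin r => qPoch (p ^ m) (n (finProdFinEquiv z))),
      finProdFinEquiv.prod_comp (fun t => qPoch (p ^ m) (n t))]
  have hlin : ∑ t, (n t : ℝ) * B' t =
      ∑ i, (∑ u : Fin m, (n (finProdFinEquiv (u, i)) : ℝ) * (2 * (u : ℝ) - m + 1) / (2 * m)
        + N i * B i / m) := by
    rw [← finProdFinEquiv.sum_comp, Fintype.sum_prod_type_right]
    refine Finset.sum_congr rfl fun i _ => ?_
    rw [← hNr i, Finset.sum_mul, Finset.sum_div, ← Finset.sum_add_distrib]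
    refine Finset.sum_congr rfl fun u _ => ?_
    rw [nahm_lin hr hm B B' hB']
    ring
  have hquad := nahm_quad hr A A' hA' (fun t => (n t : ℝ))
  simp only [hNr] at hquad
  have hpow : ∀ i, ∀ u : Fin m, (p ^ (u : ℕ)) ^ (n (finProdFinEquiv (u, i))) *
        ((p ^ m) ^ ((n (finProdFinEquiv (u, i))).choose 2) /
          qPoch (p ^ m) (n (finProdFinEquiv (u, i)))) =
      p ^ ((u : ℝ) * n (finProdFinEquiv (u, i)) + m * ((n (finProdFinEquiv (u, i)) : ℝ) *
        (n (finProdFinEquiv (u, i)) - 1) / 2)) / qPoch (p ^ m) (n (finProdFinEquiv (u, i))) := by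
    intro i u
    rw [← Nat.cast_choose_two, Real.rpow_add h0, ← Nat.cast_mul, ← Nat.cast_mul,
      Real.rpow_natCast, Real.rpow_natCast, pow_mul, pow_mul, mul_div_assoc]
  simp_rw [hpow, Finset.prod_div_distrib]
  rw [← hden]
  simp_rw [← Real.rpow_sum_of_pos h0]
  have hch : ∏ i, p ^ ((N i).choose 2) = p ^ (∑ i, (N i : ℝ) * (N i - 1) / 2) := by
    rw [Real.rpow_sum_of_pos h0]
    refine Finset.prod_congr rfl fun i _ => ?_
    rw [← Nat.cast_choose_two, Real.rpow_natCast]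
  rw [hch, ← mul_div_assoc, ← Real.rpow_sub h0, ← Real.rpow_add h0, ← Real.rpow_natCast p m,
    ← Real.rpow_mul h0.le, hquad, hlin]
  congr 2
  have e1 : ∀ i, ∑ u : Fin m, (n (finProdFinEquiv (u, i)) : ℝ) * (2 * (u : ℝ) - m + 1) / (2 * m) =
      (∑ u : Fin m, (u : ℝ) * n (finProdFinEquiv (u, i))) / m + (1 - m) / (2 * m) * N i := by
    intro i
    rw [← hNr i, Finset.mul_sum, Finset.sum_div, ← Finset.sum_add_distrib]
    refine Finset.sum_congr rfl fun u _ => ?_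
    field_simp
    ring
  have e2 : ∀ i, ∑ u : Fin m, ((u : ℝ) * n (finProdFinEquiv (u, i)) +
      m * ((n (finProdFinEquiv (u, i)) : ℝ) * (n (finProdFinEquiv (u, i)) - 1) / 2)) =
      (∑ u : Fin m, (u : ℝ) * n (finProdFinEquiv (u, i))) +
       m / 2 * (∑ u, (n (finProdFinEquiv (u, i)) : ℝ) ^ 2) - m / 2 * N i := by
    intro i
    rw [← hNr i, Finset.mul_sum, Finset.mul_sum, ← Finset.sum_add_distrib,
      ← Finset.sum_sub_distrib]
    refine Finset.sum_congr rfl fun u _ => ?_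
    ring
  have e3 : ∑ i, (N i : ℝ) * (N i - 1) / 2 = (∑ i, (N i : ℝ) ^ 2) / 2 - (∑ i, (N i : ℝ)) / 2 := by
    rw [Finset.sum_div, Finset.sum_div, ← Finset.sum_sub_distrib]
    refine Finset.sum_congr rfl fun u _ => ?_
    ring
  simp_rw [e1, e2, e3, Finset.sum_sub_distrib, Finset.sum_add_distrib, ← Finset.mul_sum,
    ← Finset.sum_div]
  field_simp
  ring

/-- Let `A` be a real positive definite symmetric `r × r` matrix,
`B ∈ ℝ^r`, `C ∈ ℝ`, `m ≥ 1`.  Let `A' = I_{mr} + E_m ⊗ (A - I_r)` (indexing coordinate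
`t` of `ℝ^{mr}` as `t = (u-1)r + i`, so `A'_{t,s} = δ_{t,s} + (1/m)(A_{t%r,s%r} - δ_{t%r,s%r})`
in 0-based indices), `B'_t = (2(t+1) - mr - 1)/(2mr) + (1/m)(B_{t%r} - (2(t%r+1)-r-1)/(2r))`
(0-based `t`), and `C' = C/m`.  Then `A'` is positive definite and
`F_{A',B',C'}(q) = F_{A,B,C}(q^{1/m})` for every `q ∈ (0,1)`. -/
theorem nahmSum_tensor_trick {r m : ℕ} (hr : 0 < r) (hm : 0 < m)
    (A : Matrix (Fin r) (Fin r) ℝ) (hA : A.PosDef) (hAs : A.IsSymm)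
    (B : Fin r → ℝ) (C : ℝ)
    (A' : Matrix (Fin (m * r)) (Fin (m * r)) ℝ)
    (hA' : ∀ t s : Fin (m * r), A' t s =
      (if t = s then (1 : ℝ) else 0) +
        (1 / (m : ℝ)) *
          (A ⟨t.val % r, Nat.mod_lt _ hr⟩ ⟨s.val % r, Nat.mod_lt _ hr⟩ -
            if t.val % r = s.val % r then (1 : ℝ) else 0))
    (B' : Fin (m * r) → ℝ)
    (hB' : ∀ t : Fin (m * r), B' t =
      (2 * ((t.val : ℝ) + 1) - (m : ℝ) * r - 1) / (2 * (m : ℝ) * r) +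
        (1 / (m : ℝ)) *
          (B ⟨t.val % r, Nat.mod_lt _ hr⟩ -
            (2 * (((t.val % r : ℕ) : ℝ) + 1) - (r : ℝ) - 1) / (2 * (r : ℝ)))) :
    A'.PosDef ∧
      ∀ q ∈ Set.Ioo (0 : ℝ) 1,
        nahmSum A' B' (C / m) q = nahmSum A B C (q ^ ((1 : ℝ) / m)) := by
  refine ⟨nahm_posDef hr hm A hA hAs A' hA', ?_⟩
  rintro q ⟨hq0, hq1⟩
  have hm' : (m : ℝ) ≠ 0 := by positivity
  obtain ⟨p, hp⟩ : ∃ p, p = q ^ ((1 : ℝ) / m) := ⟨_, rfl⟩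
  have hp0 : 0 < p := hp ▸ Real.rpow_pos_of_pos hq0 _
  have hp1 : p < 1 := hp ▸ Real.rpow_lt_one hq0.le hq1 (by positivity)
  have hpq : q = p ^ m := by
    rw [hp, ← Real.rpow_natCast, ← Real.rpow_mul hq0.le, one_div_mul_cancel hm', Real.rpow_one]
  rw [← hp]
  clear hp
  subst hpq
  unfold nahmSum
  let e : (Fin r → Fin m → ℕ) ≃ (Fin (m * r) → ℕ) :=
    ((Equiv.piComm (fun (_ : Fin r) (_ : Fin m) => ℕ)).trans
      (Equiv.curry (Fin m) (Fin r) ℕ).symm).trans (finProdFinEquiv.arrowCongr (Equiv.refl ℕ))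
  have he : ∀ k u i, e k (finProdFinEquiv (u, i)) = k i u := by
    intro k u i
    simp [e, Equiv.arrowCongr, Equiv.piComm]
  rw [← e.tsum_eq]
  rw [nahm_tsum_fiber (fun (k : Fin r → Fin m → ℕ) (i : Fin r) => ∑ u, k i u)
    (fun N => Fintype.piFinset fun i => Finset.piAntidiag Finset.univ (N i))
    (by
      intro k N
      simp [Fintype.mem_piFinset, funext_iff])
    _ (fun k => div_nonneg (Real.rpow_nonneg hq0.le _)
      (Finset.prod_nonneg fun t _ => (nahm_qPoch_pos hq0 hq1 _).le))]
  refine tsum_congr fun N => ?_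
  have hterm : ∀ k ∈ Fintype.piFinset fun i : Fin r =>
      Finset.piAntidiag (Finset.univ : Finset (Fin m)) (N i), _ := fun k hk =>
    nahm_term hr hm A B C A' hA' B' hB' hp0 (e k) N (by
      intro i
      simp only [he]
      have := Fintype.mem_piFinset.1 hk i
      simpa using this)
  rw [Finset.sum_congr rfl hterm]
  simp only [he]
  rw [← Finset.mul_sum, ← Finset.prod_univ_sum (fun i : Fin r =>
      Finset.piAntidiag (Finset.univ : Finset (Fin m)) (N i))
    (fun i k => ∏ u : Fin m, ((p ^ (u : ℕ)) ^ (k u) *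
      ((p ^ m) ^ ((k u).choose 2) / qPoch (p ^ m) (k u))))]
  simp_rw [nahm_column hp0 hp1 m hm, Finset.prod_div_distrib]
  have hne : ∏ i, p ^ ((N i).choose 2) ≠ 0 :=
    Finset.prod_ne_zero_iff.2 fun i _ => (pow_pos hp0 _).ne'
  rw [div_mul_div_cancel₀ hne]
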